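/- For every p ∈ (1,∞) there exists a constant C_p > 0 such that for every trigonometric polynomial f(e^{iθ}, e^{iγ}) = Σ_{(j,k)∈ℤ²} a_{jk} e^{ijθ} e^{ikγ} on the 2-torus, the function S f(e^{iθ}, e^{iγ}) = Σ_{j≥0, j+k+1≥0} a_{jk} e^{ijθ} e^{ikγ} satisfies ‖S f‖_{L^p(𝕋²)} ≤ C_p ‖f‖_{L^p(𝕋²)}. Consequently the Szegő projection S, the orthogonal projection of L²(𝕋²) onto the closed span of {e^{ijθ} e^{ikγ} : j ≥ 0, j+k+1 ≥ 0}, extends to a bounded operator on L^p(𝕋²) for every 1 < p < ∞. -/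

import Mathlib

open MeasureTheory Real Complex Set Filter
open scoped ENNReal

noncomputable section

open scoped Topology ComplexConjugate

/-- Differentiation under an interval integral for jointly continuous data. -/
theorem hasDerivAt_intervalIntegral_of_continuous {G G' : ℝ → ℝ → ℝ} {a b : ℝ}
    (hG : ∀ t, Continuous (G t)) (hG' : Continuous (Function.uncurry G'))
    (h : ∀ t x, HasDerivAt (fun t => G t x) (G' t x) t) (t : ℝ) :
    HasDerivAt (fun t => ∫ x in a..b, G t x) (∫ x in a..b, G' t x) t := by
  obtain ⟨B, hB⟩ := ((isCompact_Icc (a := t - 1) (b := t + 1)).prod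
    (isCompact_uIcc (a := a) (b := b))).exists_bound_of_continuousOn hG'.continuousOn
  refine (intervalIntegral.hasDerivAt_integral_of_dominated_loc_of_deriv_le
    (s := Icc (t - 1) (t + 1)) (bound := fun _ => B)
    (Icc_mem_nhds (by linarith) (by linarith))
    (Eventually.of_forall fun s => (hG s).aestronglyMeasurable)
    ((hG t).intervalIntegrable _ _)
    (hG'.comp (by fun_prop : Continuous fun x : ℝ => (t, x))).aestronglyMeasurable
    (Eventually.of_forall fun x hx s hs => hB (s, x) ⟨hs, uIoc_subset_uIcc hx⟩)
    (by simp) (Eventually.of_forall fun x _ s _ => h s x)).2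

/-- Circular means of a subharmonic function are convex in logarithmic coordinates. -/
theorem convexOn_intervalIntegral_of_laplacian_nonneg {G Gt Gtt Gx Gxx : ℝ → ℝ → ℝ} {a b : ℝ}
    (hab : a ≤ b)
    (hG : Continuous (Function.uncurry G)) (hGt : Continuous (Function.uncurry Gt))
    (hGtt : Continuous (Function.uncurry Gtt)) (hGxx : Continuous (Function.uncurry Gxx))
    (h1 : ∀ t x, HasDerivAt (fun t => G t x) (Gt t x) t)
    (h2 : ∀ t x, HasDerivAt (fun t => Gt t x) (Gtt t x) t)
    (h3 : ∀ t x, HasDerivAt (fun x => Gx t x) (Gxx t x) x)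
    (hper : ∀ t, Gx t a = Gx t b) (hlap : ∀ t x, 0 ≤ Gtt t x + Gxx t x) :
    ConvexOn ℝ univ (fun t => ∫ x in a..b, G t x) := by
  have sect : ∀ {K : ℝ → ℝ → ℝ}, Continuous (Function.uncurry K) → ∀ t, Continuous (K t) :=
    fun hK t => hK.comp (by fun_prop : Continuous fun x : ℝ => (t, x))
  have d1 := hasDerivAt_intervalIntegral_of_continuous (a := a) (b := b) (sect hG) hGt h1
  have d2 := hasDerivAt_intervalIntegral_of_continuous (a := a) (b := b) (sect hGt) hGtt h2
  have e1 : deriv (fun t => ∫ x in a..b, G t x) = fun t => ∫ x in a..b, Gt t x :=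
    funext fun t => (d1 t).deriv
  refine convexOn_univ_of_deriv2_nonneg (fun t => (d1 t).differentiableAt)
    (by rw [e1]; exact fun t => (d2 t).differentiableAt) fun t => ?_
  have e2 : deriv^[2] (fun t => ∫ x in a..b, G t x) t = ∫ x in a..b, Gtt t x := by
    simp only [Function.iterate_succ, Function.iterate_zero, Function.comp, id, e1]
    exact (d2 t).deriv
  have e3 : ∫ x in a..b, Gxx t x = 0 := by
    rw [intervalIntegral.integral_eq_sub_of_hasDerivAt (fun x _ => h3 t x)
      ((sect hGxx t).intervalIntegrable _ _), hper, sub_self]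
  have e4 := intervalIntegral.integral_add
    ((sect hGtt t).intervalIntegrable (μ := volume) a b) ((sect hGxx t).intervalIntegrable a b)
  rw [e3, add_zero] at e4
  rw [e2, ← e4]
  exact intervalIntegral.integral_nonneg hab fun x _ => hlap t x

/-- A convex function of `t` with a limit at `-∞` stays above that limit. -/
theorem ConvexOn.ge_of_tendsto_atBot {M : ℝ → ℝ} (hM : ConvexOn ℝ univ M) {L : ℝ}
    (hL : Tendsto M atBot (𝓝 L)) : L ≤ M 0 := by
  have h2 : Tendsto (fun t : ℝ => M (2 * t)) atBot (𝓝 L) :=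
    hL.comp (tendsto_id.const_mul_atBot (by norm_num))
  have h : ∀ t, M t ≤ (1 / 2) * M (2 * t) + (1 / 2) * M 0 := fun t => by
    have h := hM.2
    have := h (mem_univ (2 * t)) (mem_univ 0) (a := 1 / 2) (b := 1 / 2)
      (by norm_num) (by norm_num) (by norm_num)
    simpa using this
  have := le_of_tendsto_of_tendsto' hL ((h2.const_mul (1 / 2)).add_const ((1 / 2) * M 0)) h
  linarith

theorem hasDerivAt_mul_rpow_sub_one {N N' : ℝ → ℝ} {N'' x s : ℝ} (hN : 0 < N x)
    (h1 : HasDerivAt N (N' x) x) (h2 : HasDerivAt N' N'' x) :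
    HasDerivAt (fun x => s * N x ^ (s - 1) * N' x)
      (s * N x ^ (s - 1) * N'' + s * (s - 1) * N x ^ (s - 2) * N' x ^ 2) x := by
  have := ((h1.rpow_const (p := s - 1) (Or.inl hN.ne')).const_mul s).mul h2
  refine this.congr_deriv ?_
  rw [show s - 1 - 1 = s - 2 by ring]
  ring

theorem hasDerivAt_two_mul_inner {E : Type*} [NormedAddCommGroup E] [InnerProductSpace ℝ E]
    {u v : ℝ → E} {w : E} {x : ℝ} (h1 : HasDerivAt u (v x) x) (h2 : HasDerivAt v w x) :
    HasDerivAt (fun x => 2 * inner ℝ (u x) (v x))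
      (2 * ‖v x‖ ^ 2 + 2 * inner ℝ (u x) w) x := by
  refine ((h1.inner ℝ h2).const_mul 2).congr_deriv ?_
  rw [real_inner_self_eq_norm_sq]
  ring

/-- `u` is a harmonic function on the plane, with `t`-derivatives `ut`, `utt` and `x`-derivatives
`ux`, `-utt`. -/
structure IsHarmonicFamily {E : Type*} [NormedAddCommGroup E] [NormedSpace ℝ E]
    (u ut utt ux : ℝ → ℝ → E) : Prop where
  cont : Continuous (Function.uncurry u)
  cont_t : Continuous (Function.uncurry ut)
  cont_tt : Continuous (Function.uncurry utt)
  cont_x : Continuous (Function.uncurry ux)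
  deriv_t : ∀ t x, HasDerivAt (fun t => u t x) (ut t x) t
  deriv_tt : ∀ t x, HasDerivAt (fun t => ut t x) (utt t x) t
  deriv_x : ∀ t x, HasDerivAt (fun x => u t x) (ux t x) x
  deriv_xx : ∀ t x, HasDerivAt (fun x => ux t x) (-utt t x) x

section NormPow

variable {E : Type*} [NormedAddCommGroup E] [InnerProductSpace ℝ E]

/-- The function `(‖u‖² + c)ˢ`. -/
def normPow (c s : ℝ) (u : E) : ℝ := (‖u‖ ^ 2 + c) ^ s

/-- The derivative of `(‖u‖² + c)ˢ` in the direction `v`. -/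
def normPowDeriv (c s : ℝ) (u v : E) : ℝ := s * (‖u‖ ^ 2 + c) ^ (s - 1) * (2 * inner ℝ u v)

/-- The second derivative of `(‖u‖² + c)ˢ` along a curve with velocity `v` and acceleration `w`. -/
def normPowDeriv2 (c s : ℝ) (u v w : E) : ℝ :=
  s * (‖u‖ ^ 2 + c) ^ (s - 1) * (2 * ‖v‖ ^ 2 + 2 * inner ℝ u w) +
    s * (s - 1) * (‖u‖ ^ 2 + c) ^ (s - 2) * (2 * inner ℝ u v) ^ 2

/-- The Laplacian of `(‖u‖² + c)ˢ` for harmonic `u`. -/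
theorem normPowDeriv2_add_neg (c s : ℝ) (u v v' w : E) :
    normPowDeriv2 c s u v w + normPowDeriv2 c s u v' (-w) =
      2 * s * (‖u‖ ^ 2 + c) ^ (s - 1) * (‖v‖ ^ 2 + ‖v'‖ ^ 2) +
        4 * s * (s - 1) * (‖u‖ ^ 2 + c) ^ (s - 2) * (inner ℝ u v ^ 2 + inner ℝ u v' ^ 2) := by
  simp only [normPowDeriv2, inner_neg_right]
  ring

theorem continuous_normPow {E : Type*} [NormedAddCommGroup E] {c : ℝ} (hc : 0 < c) (s : ℝ)
    {X : Type*} [TopologicalSpace X] {u : X → E} (hu : Continuous u) :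
    Continuous fun x => normPow c s (u x) :=
  ((hu.norm.pow 2).add continuous_const).rpow_const fun x =>
    Or.inl (by positivity : 0 < ‖u x‖ ^ 2 + c).ne'

theorem continuous_normPowDeriv {c : ℝ} (hc : 0 < c) (s : ℝ)
    {X : Type*} [TopologicalSpace X] {u v : X → E}
    (hu : Continuous u) (hv : Continuous v) : Continuous fun x => normPowDeriv c s (u x) (v x) :=
  (continuous_const.mul (continuous_normPow hc (s - 1) hu)).mul
    (continuous_const.mul (hu.inner hv))

theorem continuous_normPowDeriv2 {c : ℝ} (hc : 0 < c) (s : ℝ)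
    {X : Type*} [TopologicalSpace X] {u v w : X → E}
    (hu : Continuous u) (hv : Continuous v) (hw : Continuous w) :
    Continuous fun x => normPowDeriv2 c s (u x) (v x) (w x) :=
  ((continuous_const.mul (continuous_normPow hc (s - 1) hu)).mul
    ((continuous_const.mul (hv.norm.pow 2)).add (continuous_const.mul (hu.inner hw)))).add
  ((continuous_const.mul (continuous_normPow hc (s - 2) hu)).mul
    ((continuous_const.mul (hu.inner hv)).pow 2))

theorem hasDerivAt_normPow {c : ℝ} (hc : 0 < c) (s : ℝ)
    {u : ℝ → E} {v : E} {x : ℝ} (h : HasDerivAt u v x) :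
    HasDerivAt (fun x => normPow c s (u x)) (normPowDeriv c s (u x) v) x := by
  refine ((h.norm_sq.add_const c).rpow_const (p := s)
    (Or.inl (by positivity))).congr_deriv ?_
  rw [normPowDeriv]
  ring

theorem hasDerivAt_normPowDeriv {c : ℝ} (hc : 0 < c) (s : ℝ)
    {u v : ℝ → E} {w : E} {x : ℝ} (h : HasDerivAt u (v x) x)
    (h' : HasDerivAt v w x) :
    HasDerivAt (fun x => normPowDeriv c s (u x) (v x)) (normPowDeriv2 c s (u x) (v x) w) x :=
  hasDerivAt_mul_rpow_sub_one (N := fun x => ‖u x‖ ^ 2 + c) (s := s)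
    (by positivity) (h.norm_sq.add_const c) (hasDerivAt_two_mul_inner h h')

theorem laplacian_normPow_le {c : ℝ} (hc : 0 < c) {s : ℝ} (hs0 : 0 ≤ s) (hs1 : s ≤ 1)
    (u v v' w : E) :
    normPowDeriv2 c s u v w + normPowDeriv2 c s u v' (-w) ≤
      2 * s * (‖u‖ ^ 2 + c) ^ (s - 1) * (‖v‖ ^ 2 + ‖v'‖ ^ 2) := by
  rw [normPowDeriv2_add_neg]
  have : 0 ≤ s * (1 - s) * (‖u‖ ^ 2 + c) ^ (s - 2) * (inner ℝ u v ^ 2 + inner ℝ u v' ^ 2) := by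
    have : 0 ≤ 1 - s := by linarith
    positivity
  linarith

theorem le_laplacian_normPow {c : ℝ} (hc : 0 < c) {s : ℝ} (hs0 : 0 ≤ s) (hs1 : s ≤ 1)
    (u v v' w : E) :
    2 * s * (2 * s - 1) * (‖u‖ ^ 2 + c) ^ (s - 1) * (‖v‖ ^ 2 + ‖v'‖ ^ 2) ≤
      normPowDeriv2 c s u v w + normPowDeriv2 c s u v' (-w) := by
  rw [normPowDeriv2_add_neg]
  have hN : 0 < ‖u‖ ^ 2 + c := by positivity
  have e : (‖u‖ ^ 2 + c) ^ (s - 1) = (‖u‖ ^ 2 + c) ^ (s - 2) * (‖u‖ ^ 2 + c) := by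
    rw [← Real.rpow_add_one hN.ne']
    ring_nf
  have cs : ∀ y : E, inner ℝ u y ^ 2 ≤ ‖u‖ ^ 2 * ‖y‖ ^ 2 := fun y => by
    rw [← mul_pow, ← sq_abs]
    gcongr
    exact abs_real_inner_le_norm u y
  have key : 0 ≤ s * (1 - s) * (‖u‖ ^ 2 + c) ^ (s - 2) *
      ((‖u‖ ^ 2 + c) * (‖v‖ ^ 2 + ‖v'‖ ^ 2) - (inner ℝ u v ^ 2 + inner ℝ u v' ^ 2)) := by
    have h1 : 0 ≤ 1 - s := by linarith
    have h2 : 0 ≤ (‖u‖ ^ 2 + c) * (‖v‖ ^ 2 + ‖v'‖ ^ 2) - (inner ℝ u v ^ 2 + inner ℝ u v' ^ 2) := by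
      have := cs v
      have := cs v'
      have : 0 ≤ c * (‖v‖ ^ 2 + ‖v'‖ ^ 2) := by positivity
      linarith
    positivity
  rw [e]
  linarith

end NormPow

/-- Convexity of circular means for a difference of powers of norms of harmonic functions. -/
theorem convexOn_integral_normPow_sub {E F : Type*} [NormedAddCommGroup E] [InnerProductSpace ℝ E]
    [NormedAddCommGroup F] [InnerProductSpace ℝ F]
    {u ut utt ux : ℝ → ℝ → E} {v vt vtt vx : ℝ → ℝ → F}
    (hu : IsHarmonicFamily u ut utt ux) (hv : IsHarmonicFamily v vt vtt vx)
    {a b : ℝ} (hab : a ≤ b) (pu : ∀ t, u t a = u t b) (pux : ∀ t, ux t a = ux t b)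
    (pv : ∀ t, v t a = v t b) (pvx : ∀ t, vx t a = vx t b)
    {c d s A : ℝ} (hc : 0 < c) (hd : 0 < d) (hs : 1 / 2 ≤ s) (hs1 : s ≤ 1) (hA : 0 ≤ A)
    (hlap : ∀ t x, (‖v t x‖ ^ 2 + d) ^ (s - 1) * (‖vt t x‖ ^ 2 + ‖vx t x‖ ^ 2) ≤
      A * ((2 * s - 1) * (‖u t x‖ ^ 2 + c) ^ (s - 1) * (‖ut t x‖ ^ 2 + ‖ux t x‖ ^ 2))) :
    ConvexOn ℝ univ fun t => ∫ x in a..b, (A * normPow c s (u t x) - normPow d s (v t x)) := by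
  refine convexOn_intervalIntegral_of_laplacian_nonneg hab
    (Gt := fun t x => A * normPowDeriv c s (u t x) (ut t x) - normPowDeriv d s (v t x) (vt t x))
    (Gtt := fun t x => A * normPowDeriv2 c s (u t x) (ut t x) (utt t x) -
      normPowDeriv2 d s (v t x) (vt t x) (vtt t x))
    (Gx := fun t x => A * normPowDeriv c s (u t x) (ux t x) - normPowDeriv d s (v t x) (vx t x))
    (Gxx := fun t x => A * normPowDeriv2 c s (u t x) (ux t x) (-utt t x) -
      normPowDeriv2 d s (v t x) (vx t x) (-vtt t x))
    ((continuous_const.mul (continuous_normPow hc s hu.cont)).sub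
      (continuous_normPow hd s hv.cont))
    ((continuous_const.mul (continuous_normPowDeriv hc s hu.cont hu.cont_t)).sub
      (continuous_normPowDeriv hd s hv.cont hv.cont_t))
    ((continuous_const.mul (continuous_normPowDeriv2 hc s hu.cont hu.cont_t hu.cont_tt)).sub
      (continuous_normPowDeriv2 hd s hv.cont hv.cont_t hv.cont_tt))
    ((continuous_const.mul (continuous_normPowDeriv2 hc s hu.cont hu.cont_x hu.cont_tt.neg)).sub
      (continuous_normPowDeriv2 hd s hv.cont hv.cont_x hv.cont_tt.neg))
    (fun t x => ((hasDerivAt_normPow hc s (hu.deriv_t t x)).const_mul A).sub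
      (hasDerivAt_normPow hd s (hv.deriv_t t x)))
    (fun t x => ((hasDerivAt_normPowDeriv hc s (v := fun t => ut t x) (hu.deriv_t t x)
      (hu.deriv_tt t x)).const_mul A).sub
      (hasDerivAt_normPowDeriv hd s (v := fun t => vt t x) (hv.deriv_t t x) (hv.deriv_tt t x)))
    (fun t x => ((hasDerivAt_normPowDeriv hc s (v := fun x => ux t x) (hu.deriv_x t x)
      (hu.deriv_xx t x)).const_mul A).sub
      (hasDerivAt_normPowDeriv hd s (v := fun x => vx t x) (hv.deriv_x t x) (hv.deriv_xx t x)))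
    (fun t => by simp only [pu, pux, pv, pvx]) fun t x => ?_
  have h1 := mul_le_mul_of_nonneg_left
    (le_laplacian_normPow hc (by linarith) hs1 (u t x) (ut t x) (ux t x) (utt t x)) hA
  have h2 := laplacian_normPow_le hd (by linarith) hs1 (v t x) (vt t x) (vx t x) (vtt t x)
  have h3 := mul_le_mul_of_nonneg_left (hlap t x) (by linarith : 0 ≤ 2 * s)
  linarith

/-- The Euler operator `z ↦ z * g' z`. -/
def eulerDeriv (g : ℂ → ℂ) (z : ℂ) : ℂ := z * deriv g z

theorem Differentiable.eulerDeriv {g : ℂ → ℂ} (hg : Differentiable ℂ g) :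
    Differentiable ℂ (eulerDeriv g) :=
  differentiable_id.mul hg.deriv

theorem hasDerivAt_comp_exp_radial {g : ℂ → ℂ} (hg : Differentiable ℂ g) (t x : ℝ) :
    HasDerivAt (fun t : ℝ => g (cexp (t + x * I))) (eulerDeriv g (cexp (t + x * I))) t := by
  have h1 : HasDerivAt (fun t : ℝ => cexp (t + x * I)) (cexp (t + x * I) * 1) t :=
    ((Complex.ofRealCLM.hasDerivAt (x := t)).add_const _).cexp
  refine ((hg _).hasDerivAt.comp t h1).congr_deriv ?_
  rw [eulerDeriv]
  ring

theorem hasDerivAt_comp_exp_angular {g : ℂ → ℂ} (hg : Differentiable ℂ g) (t x : ℝ) :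
    HasDerivAt (fun x : ℝ => g (cexp (t + x * I))) (I * eulerDeriv g (cexp (t + x * I))) x := by
  have h1 : HasDerivAt (fun x : ℝ => cexp (t + x * I)) (cexp (t + x * I) * (1 * I)) x :=
    (((Complex.ofRealCLM.hasDerivAt (x := x)).mul_const I).const_add _).cexp
  refine ((hg _).hasDerivAt.comp x h1).congr_deriv ?_
  rw [eulerDeriv]
  ring

/-- Real-linear images of pairs of holomorphic functions are harmonic. -/
theorem isHarmonicFamily_comp_exp {E : Type*} [NormedAddCommGroup E] [NormedSpace ℝ E]
    (L : ℂ × ℂ →L[ℝ] E) {W Z : ℂ → ℂ} (hW : Differentiable ℂ W) (hZ : Differentiable ℂ Z) :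
    IsHarmonicFamily (fun t x => L (W (cexp (t + x * I)), Z (cexp (t + x * I))))
      (fun t x => L (eulerDeriv W (cexp (t + x * I)), eulerDeriv Z (cexp (t + x * I))))
      (fun t x => L (eulerDeriv (eulerDeriv W) (cexp (t + x * I)),
        eulerDeriv (eulerDeriv Z) (cexp (t + x * I))))
      (fun t x => L (I * eulerDeriv W (cexp (t + x * I)),
        I * eulerDeriv Z (cexp (t + x * I)))) := by
  have cont : ∀ {f g : ℂ → ℂ}, Differentiable ℂ f → Differentiable ℂ g →
      Continuous (Function.uncurry fun t x : ℝ => L (f (cexp (t + x * I)), g (cexp (t + x * I)))) := by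
    intro f g hf hg
    have := hf.continuous
    have := hg.continuous
    unfold Function.uncurry
    fun_prop
  refine ⟨cont hW hZ, cont hW.eulerDeriv hZ.eulerDeriv, cont hW.eulerDeriv.eulerDeriv
    hZ.eulerDeriv.eulerDeriv, cont (hW.eulerDeriv.const_mul I) (hZ.eulerDeriv.const_mul I), ?_, ?_,
    ?_, ?_⟩ <;> intro t x
  · exact L.hasFDerivAt.comp_hasDerivAt t
      ((hasDerivAt_comp_exp_radial hW t x).prodMk (hasDerivAt_comp_exp_radial hZ t x))
  · exact L.hasFDerivAt.comp_hasDerivAt t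
      ((hasDerivAt_comp_exp_radial hW.eulerDeriv t x).prodMk
        (hasDerivAt_comp_exp_radial hZ.eulerDeriv t x))
  · exact L.hasFDerivAt.comp_hasDerivAt x
      ((hasDerivAt_comp_exp_angular hW t x).prodMk (hasDerivAt_comp_exp_angular hZ t x))
  · refine (L.hasFDerivAt.comp_hasDerivAt x
      (((hasDerivAt_comp_exp_angular hW.eulerDeriv t x).const_mul I).prodMk
        ((hasDerivAt_comp_exp_angular hZ.eulerDeriv t x).const_mul I))).congr_deriv ?_
    rw [← map_neg]
    simp [← mul_assoc]

/-- The real-linear map `(w, z) ↦ w + conj z`. -/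
def addConjCLM : ℂ × ℂ →L[ℝ] ℂ :=
  ContinuousLinearMap.fst ℝ ℂ ℂ +
    (Complex.conjCLE : ℂ →L[ℝ] ℂ).comp (ContinuousLinearMap.snd ℝ ℂ ℂ)

theorem addConjCLM_apply (w z : ℂ) : addConjCLM (w, z) = w + conj z := by
  simp [addConjCLM]

/-- The identification of `ℂ × ℂ` with the Euclidean space `ℂ²`. -/
def toLpCLM : ℂ × ℂ →L[ℝ] WithLp 2 (ℂ × ℂ) :=
  ((WithLp.prodContinuousLinearEquiv 2 ℝ ℂ ℂ).symm : ℂ × ℂ →L[ℝ] WithLp 2 (ℂ × ℂ))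

theorem norm_toLpCLM_sq (w z : ℂ) : ‖toLpCLM (w, z)‖ ^ 2 = ‖w‖ ^ 2 + ‖z‖ ^ 2 := by
  rw [WithLp.prod_norm_sq_eq_of_L2]
  simp [toLpCLM]

theorem norm_addConjCLM_sq_add (w z : ℂ) :
    ‖addConjCLM (w, z)‖ ^ 2 + ‖addConjCLM (I * w, I * z)‖ ^ 2 = 2 * (‖w‖ ^ 2 + ‖z‖ ^ 2) := by
  simp only [addConjCLM_apply, ← Complex.normSq_eq_norm_sq, Complex.normSq_apply]
  simp
  ring

theorem norm_addConjCLM_sq_le (w z : ℂ) :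
    ‖addConjCLM (w, z)‖ ^ 2 ≤ 2 * (‖w‖ ^ 2 + ‖z‖ ^ 2) := by
  rw [← norm_addConjCLM_sq_add]
  exact le_add_of_nonneg_right (by positivity)

theorem cexp_periodic_boundary (t : ℝ) :
    cexp (t + (0 : ℝ) * I) = cexp (t + (2 * π : ℝ) * I) := by
  have := Complex.exp_periodic (t : ℂ)
  push_cast
  simpa using this.symm

/-- The regularised Riesz inequality for `p = 2 * s ∈ (1, 2]`. -/
theorem integral_normPow_toLp_le {W Z : ℂ → ℂ} (hW : Differentiable ℂ W) (hZ : Differentiable ℂ Z)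
    (hZ0 : Z 0 = 0) {s : ℝ} (hs : 1 / 2 < s) (hs1 : s ≤ 1) {ε : ℝ} (hε : 0 < ε) :
    ∫ x in (0 : ℝ)..(2 * π), (‖W (cexp (x * I))‖ ^ 2 + ‖Z (cexp (x * I))‖ ^ 2 + ε) ^ s ≤
      2 / (2 * s - 1) * ∫ x in (0 : ℝ)..(2 * π),
        (‖W (cexp (x * I)) + conj (Z (cexp (x * I)))‖ ^ 2 + 2 * ε) ^ s := by
  set A : ℝ := 2 / (2 * s - 1) with hA_def
  have hs' : 0 < 2 * s - 1 := by linarith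
  have hA1 : 1 ≤ A := by rw [hA_def, le_div_iff₀ hs']; linarith
  have h2ε : 0 < 2 * ε := by linarith
  have hconv := convexOn_integral_normPow_sub (isHarmonicFamily_comp_exp addConjCLM hW hZ)
    (isHarmonicFamily_comp_exp toLpCLM hW hZ) (a := 0) (b := 2 * π) (by positivity)
    (fun t => by simp only [cexp_periodic_boundary t])
    (fun t => by simp only [cexp_periodic_boundary t])
    (fun t => by simp only [cexp_periodic_boundary t])
    (fun t => by simp only [cexp_periodic_boundary t])
    h2ε hε hs.le hs1 (by linarith : 0 ≤ A) (fun t x => by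
      set w := W (cexp (t + x * I))
      set z := Z (cexp (t + x * I))
      set w' := eulerDeriv W (cexp (t + x * I))
      set z' := eulerDeriv Z (cexp (t + x * I))
      rw [norm_addConjCLM_sq_add, norm_toLpCLM_sq, norm_toLpCLM_sq, norm_toLpCLM_sq, norm_mul,
        norm_mul, norm_I, one_mul, one_mul, ← two_mul]
      have hN : 0 < ‖w‖ ^ 2 + ‖z‖ ^ 2 + ε := by positivity
      have h1 : (2 * (‖w‖ ^ 2 + ‖z‖ ^ 2 + ε)) ^ (s - 1) ≤
          (‖addConjCLM (w, z)‖ ^ 2 + 2 * ε) ^ (s - 1) :=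
        Real.rpow_le_rpow_of_nonpos (by positivity)
          (by linarith [norm_addConjCLM_sq_le w z]) (by linarith)
      have h2 : (1 / 2 : ℝ) ≤ 2 ^ (s - 1) := by
        rw [one_div, ← Real.rpow_neg_one]
        exact Real.rpow_le_rpow_of_exponent_le (by norm_num) (by linarith)
      rw [Real.mul_rpow (by norm_num) hN.le] at h1
      have h3 : (‖w‖ ^ 2 + ‖z‖ ^ 2 + ε) ^ (s - 1) ≤
          2 * (‖addConjCLM (w, z)‖ ^ 2 + 2 * ε) ^ (s - 1) := by
        have := mul_le_mul_of_nonneg_right h2 (Real.rpow_nonneg hN.le (s - 1))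
        linarith
      calc _ ≤ 2 * (‖addConjCLM (w, z)‖ ^ 2 + 2 * ε) ^ (s - 1) *
            (2 * (‖w'‖ ^ 2 + ‖z'‖ ^ 2)) := by gcongr
        _ = A * (2 * s - 1) * ((‖addConjCLM (w, z)‖ ^ 2 + 2 * ε) ^ (s - 1) *
            (2 * (‖w'‖ ^ 2 + ‖z'‖ ^ 2))) := by
          rw [hA_def, div_mul_cancel₀ _ hs'.ne']; ring
        _ = _ := by ring)
  have cW := hW.continuous
  have cZ := hZ.continuous
  let K : ℝ → ℝ := fun r => ∫ x in (0 : ℝ)..(2 * π),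
    (A * normPow (2 * ε) s (addConjCLM (W (r * cexp (x * I)), Z (r * cexp (x * I)))) -
      normPow ε s (toLpCLM (W (r * cexp (x * I)), Z (r * cexp (x * I)))))
  have cK : Continuous K := by
    refine intervalIntegral.continuous_parametric_intervalIntegral_of_continuous' ?_ _ _
    exact (continuous_const.mul (continuous_normPow h2ε s (by fun_prop))).sub
      (continuous_normPow hε s (by fun_prop))
  have hlim : Tendsto (fun t => K (Real.exp t)) atBot (𝓝 (K 0)) :=
    (cK.tendsto 0).comp Real.tendsto_exp_atBot
  have hK : (fun t => K (Real.exp t)) = fun t : ℝ => ∫ x in (0 : ℝ)..(2 * π),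
      (A * normPow (2 * ε) s (addConjCLM (W (cexp (t + x * I)), Z (cexp (t + x * I)))) -
        normPow ε s (toLpCLM (W (cexp (t + x * I)), Z (cexp (t + x * I))))) := by
    funext t
    simp only [K, Complex.ofReal_exp, Complex.exp_add]
  rw [hK] at hlim
  have hge := hconv.ge_of_tendsto_atBot hlim
  have hK0 : 0 ≤ K 0 := by
    refine intervalIntegral.integral_nonneg (by positivity) fun x _ => ?_
    simp only [Complex.ofReal_zero, zero_mul, normPow, addConjCLM_apply, norm_toLpCLM_sq, hZ0,
      map_zero, add_zero, norm_zero, ne_eq, OfNat.ofNat_ne_zero, not_false_eq_true, zero_pow]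
    have h1 : (‖W 0‖ ^ 2 + ε) ^ s ≤ (‖W 0‖ ^ 2 + 2 * ε) ^ s :=
      Real.rpow_le_rpow (by positivity) (by linarith) (by linarith)
    have h2 : 0 ≤ (‖W 0‖ ^ 2 + 2 * ε) ^ s := by positivity
    nlinarith
  have hfin := hK0.trans hge
  rw [intervalIntegral.integral_sub, intervalIntegral.integral_const_mul] at hfin
  · simpa only [normPow, addConjCLM_apply, norm_toLpCLM_sq, Complex.ofReal_zero, zero_add,
      sub_nonneg] using hfin
  · exact (continuous_const.mul
      (continuous_normPow h2ε s (by fun_prop))).intervalIntegrable _ _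
  · exact (continuous_normPow hε s (by fun_prop)).intervalIntegrable _ _

/-- The Riesz inequality for `1 < p ≤ 2`. -/
theorem integral_norm_rpow_le_of_le_two {W Z : ℂ → ℂ} (hW : Differentiable ℂ W)
    (hZ : Differentiable ℂ Z) (hZ0 : Z 0 = 0) {s : ℝ} (hs : 1 / 2 < s) (hs1 : s ≤ 1) :
    ∫ x in (0 : ℝ)..(2 * π), (‖W (cexp (x * I))‖ ^ 2 + ‖Z (cexp (x * I))‖ ^ 2) ^ s ≤
      2 / (2 * s - 1) * ∫ x in (0 : ℝ)..(2 * π),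
        (‖W (cexp (x * I)) + conj (Z (cexp (x * I)))‖ ^ 2) ^ s := by
  have cW := hW.continuous
  have cZ := hZ.continuous
  have hs0 : 0 ≤ s := by linarith
  have c1 : Continuous fun ε : ℝ => ∫ x in (0 : ℝ)..(2 * π),
      (‖W (cexp (x * I))‖ ^ 2 + ‖Z (cexp (x * I))‖ ^ 2 + ε) ^ s :=
    intervalIntegral.continuous_parametric_intervalIntegral_of_continuous'
      (Continuous.rpow_const (by fun_prop) fun _ => Or.inr hs0) _ _
  have c2 : Continuous fun ε : ℝ => 2 / (2 * s - 1) * ∫ x in (0 : ℝ)..(2 * π),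
      (‖W (cexp (x * I)) + conj (Z (cexp (x * I)))‖ ^ 2 + 2 * ε) ^ s :=
    continuous_const.mul <| intervalIntegral.continuous_parametric_intervalIntegral_of_continuous'
      (Continuous.rpow_const (by fun_prop) fun _ => Or.inr hs0) _ _
  have := le_of_tendsto_of_tendsto
    ((c1.tendsto 0).mono_left (nhdsWithin_le_nhds (s := Ioi 0)))
    ((c2.tendsto 0).mono_left (nhdsWithin_le_nhds (s := Ioi 0)))
    (eventually_nhdsWithin_of_forall fun ε hε => integral_normPow_toLp_le hW hZ hZ0 hs hs1 hε)
  simpa using this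

/-- The `Lᵖ` boundedness of `f = W + conj Z ↦ W - conj Z`, which is the Hilbert transform up to a
multiplicative constant and the mean. -/
def RieszBound (p : ℝ) : Prop :=
  ∃ C : ℝ, 0 < C ∧ ∀ W Z : ℂ → ℂ, Differentiable ℂ W → Differentiable ℂ Z → Z 0 = 0 →
    ∫ x in (0 : ℝ)..(2 * π), ‖W (cexp (x * I)) - conj (Z (cexp (x * I)))‖ ^ p ≤
      C * ∫ x in (0 : ℝ)..(2 * π), ‖W (cexp (x * I)) + conj (Z (cexp (x * I)))‖ ^ p

theorem rieszBound_of_le_two {p : ℝ} (hp : 1 < p) (hp2 : p ≤ 2) : RieszBound p := by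
  have hs' : 0 < 2 * (p / 2) - 1 := by linarith
  refine ⟨2 ^ (p / 2) * (2 / (2 * (p / 2) - 1)), by positivity, fun W Z hW hZ hZ0 => ?_⟩
  have key := integral_norm_rpow_le_of_le_two hW hZ hZ0 (s := p / 2) (by linarith) (by linarith)
  have cW := hW.continuous
  have cZ := hZ.continuous
  have e : ∀ y : ℂ, (‖y‖ ^ 2) ^ (p / 2) = ‖y‖ ^ p := fun y => by
    rw [← Real.rpow_natCast_mul (norm_nonneg y)]
    congr 1
    push_cast
    ring
  simp only [e] at key
  rw [mul_assoc]
  refine le_trans ?_ (mul_le_mul_of_nonneg_left key (by positivity))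
  rw [← intervalIntegral.integral_const_mul]
  refine intervalIntegral.integral_mono_on (by positivity)
    (Continuous.intervalIntegrable (Continuous.rpow_const (by fun_prop)
      fun _ => Or.inr (by linarith)) _ _)
    (Continuous.intervalIntegrable (continuous_const.mul (Continuous.rpow_const (by fun_prop)
      fun _ => Or.inr (by linarith))) _ _) fun x _ => ?_
  rw [← Real.mul_rpow (by norm_num) (by positivity), ← e]
  refine Real.rpow_le_rpow (by positivity) ?_ (by linarith)
  have := norm_addConjCLM_sq_le (W (cexp (x * I))) (-Z (cexp (x * I)))
  rwa [addConjCLM_apply, map_neg, ← sub_eq_add_neg, norm_neg] at this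

theorem add_rpow_le_two_rpow_mul {x y p : ℝ} (hx : 0 ≤ x) (hy : 0 ≤ y) (hp : 0 ≤ p) :
    (x + y) ^ p ≤ 2 ^ p * (x ^ p + y ^ p) := by
  have h : (x + y) ^ p ≤ (2 * max x y) ^ p :=
    Real.rpow_le_rpow (by positivity)
      (by linarith [le_max_left x y, le_max_right x y]) hp
  rw [Real.mul_rpow (by norm_num) (hx.trans (le_max_left x y))] at h
  refine h.trans (mul_le_mul_of_nonneg_left ?_ (by positivity))
  have := Real.rpow_nonneg hx p
  have := Real.rpow_nonneg hy p
  rcases max_choice x y with h | h <;> rw [h] <;> linarith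

/-- The pointwise form of Cotlar's identity. -/
theorem norm_sub_rpow_two_mul_le {p : ℝ} (hp : 0 ≤ p) (w z : ℂ) :
    ‖w - z‖ ^ (2 * p) ≤ 4 ^ p * ‖w ^ 2 + z ^ 2‖ ^ p + 2 ^ p * ‖w + z‖ ^ (2 * p) := by
  have h1 : ‖w - z‖ ^ 2 ≤ 2 * ‖w ^ 2 + z ^ 2‖ + ‖w + z‖ ^ 2 := by
    rw [← norm_pow, ← norm_pow, show (w - z) ^ 2 = 2 * (w ^ 2 + z ^ 2) - (w + z) ^ 2 by ring]
    exact (norm_sub_le _ _).trans (by simp)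
  have h2 := (Real.rpow_le_rpow (by positivity) h1 hp).trans
    (add_rpow_le_two_rpow_mul (by positivity) (by positivity) hp)
  have e : ∀ y : ℂ, (‖y‖ ^ 2) ^ p = ‖y‖ ^ (2 * p) := fun y => by
    rw [← Real.rpow_natCast_mul (norm_nonneg y)]
    norm_cast
  rw [e, e, Real.mul_rpow (by norm_num) (norm_nonneg _), mul_add, ← mul_assoc,
    ← Real.mul_rpow (by norm_num) (by norm_num)] at h2
  norm_num at h2
  exact h2

theorem norm_sq_sub_sq_rpow_le {p δ : ℝ} (hδ : 0 < δ) (w z : ℂ) :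
    ‖w ^ 2 - z ^ 2‖ ^ p ≤ δ * ‖w - z‖ ^ (2 * p) + δ⁻¹ * ‖w + z‖ ^ (2 * p) := by
  have e : ∀ y : ℂ, ‖y‖ ^ (2 * p) = (‖y‖ ^ p) ^ 2 := fun y => by
    rw [← Real.rpow_mul_natCast (norm_nonneg y), mul_comm]
    norm_cast
  rw [sq_sub_sq, norm_mul, Real.mul_rpow (norm_nonneg _) (norm_nonneg _), e, e]
  set x := ‖w + z‖ ^ p
  set y := ‖w - z‖ ^ p
  have : 0 ≤ δ * (y - δ⁻¹ * x) ^ 2 := by positivity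
  have h2 : δ * (y - δ⁻¹ * x) ^ 2 = δ * y ^ 2 - 2 * (x * y) + δ⁻¹ * x ^ 2 := by
    field_simp
    ring
  have : 0 ≤ δ * y ^ 2 + δ⁻¹ * x ^ 2 := by positivity
  linarith

/-- Cotlar's doubling argument. -/
theorem RieszBound.two_mul {p : ℝ} (hp : 0 < p) (h : RieszBound p) : RieszBound (2 * p) := by
  obtain ⟨C, hC, hb⟩ := h
  set K : ℝ := 4 ^ p * C with hK
  have hK0 : 0 < K := by positivity
  refine ⟨2 * (K * (2 * K) + 2 ^ p), by positivity, fun W Z hW hZ hZ0 => ?_⟩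
  have cW := hW.continuous
  have cZ := hZ.continuous
  have key := hb (fun x => W x ^ 2) (fun x => -Z x ^ 2) (hW.pow 2) (hZ.pow 2).neg (by simp [hZ0])
  simp only [map_neg, map_pow, sub_neg_eq_add, ← sub_eq_add_neg] at key
  set g : ℝ → ℝ := fun x => ‖W (cexp (x * I)) - conj (Z (cexp (x * I)))‖ ^ (2 * p)
  set f : ℝ → ℝ := fun x => ‖W (cexp (x * I)) + conj (Z (cexp (x * I)))‖ ^ (2 * p)
  set B : ℝ → ℝ := fun x => ‖W (cexp (x * I)) ^ 2 + conj (Z (cexp (x * I))) ^ 2‖ ^ p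
  set D : ℝ → ℝ := fun x => ‖W (cexp (x * I)) ^ 2 - conj (Z (cexp (x * I))) ^ 2‖ ^ p
  have cg : Continuous g := Continuous.rpow_const (by fun_prop) fun _ => Or.inr (by positivity)
  have cf : Continuous f := Continuous.rpow_const (by fun_prop) fun _ => Or.inr (by positivity)
  have cB : Continuous B := Continuous.rpow_const (by fun_prop) fun _ => Or.inr hp.le
  have cD : Continuous D := Continuous.rpow_const (by fun_prop) fun _ => Or.inr hp.le
  have h1 : ∫ x in (0 : ℝ)..(2 * π), g x ≤
      4 ^ p * (∫ x in (0 : ℝ)..(2 * π), B x) + 2 ^ p * ∫ x in (0 : ℝ)..(2 * π), f x := by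
    rw [← intervalIntegral.integral_const_mul, ← intervalIntegral.integral_const_mul,
      ← intervalIntegral.integral_add ((cB.const_mul _).intervalIntegrable _ _)
        ((cf.const_mul _).intervalIntegrable _ _)]
    exact intervalIntegral.integral_mono_on (by positivity) (cg.intervalIntegrable _ _)
      (((cB.const_mul _).add (cf.const_mul _)).intervalIntegrable _ _)
      fun x _ => norm_sub_rpow_two_mul_le hp.le _ _
  have h2 : ∫ x in (0 : ℝ)..(2 * π), D x ≤ (2 * K)⁻¹ * (∫ x in (0 : ℝ)..(2 * π), g x) +
      (2 * K)⁻¹⁻¹ * ∫ x in (0 : ℝ)..(2 * π), f x := by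
    rw [← intervalIntegral.integral_const_mul, ← intervalIntegral.integral_const_mul,
      ← intervalIntegral.integral_add ((cg.const_mul _).intervalIntegrable _ _)
        ((cf.const_mul _).intervalIntegrable _ _)]
    exact intervalIntegral.integral_mono_on (by positivity) (cD.intervalIntegrable _ _)
      (((cg.const_mul _).add (cf.const_mul _)).intervalIntegrable _ _)
      fun x _ => norm_sq_sub_sq_rpow_le (by positivity) _ _
  rw [inv_inv] at h2
  have h3 := mul_le_mul_of_nonneg_left key (by positivity : (0 : ℝ) ≤ 4 ^ p)
  rw [← mul_assoc, ← hK] at h3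
  have h4 := mul_le_mul_of_nonneg_left h2 hK0.le
  rw [mul_add, ← mul_assoc, mul_inv, mul_left_comm, mul_inv_cancel₀ hK0.ne'] at h4
  linarith

theorem rieszBound_of_one_lt {p : ℝ} (hp : 1 < p) : RieszBound p := by
  have h : ∀ n : ℕ, ∀ p : ℝ, 1 < p → p ≤ 2 ^ n * 2 → RieszBound p := by
    intro n
    induction n with
    | zero => exact fun p hp h => rieszBound_of_le_two hp (by simpa using h)
    | succ n ih =>
      intro p hp h
      rcases le_or_gt p 2 with h2 | h2
      · exact rieszBound_of_le_two hp h2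
      · have := (ih (p / 2) (by linarith) (by rw [pow_succ] at h; linarith)).two_mul (by linarith)
        rwa [mul_div_cancel₀ p two_ne_zero] at this
  obtain ⟨n, hn⟩ := pow_unbounded_of_one_lt p (one_lt_two (α := ℝ))
  exact h n p hp (by linarith)

/-- **M. Riesz's theorem**: the projection of trigonometric polynomials onto their nonnegative
frequencies is bounded in `Lᵖ` of the circle. -/
theorem exists_integral_norm_sum_nonneg_le {p : ℝ} (hp : 1 < p) :
    ∃ C : ℝ, 0 < C ∧ ∀ {ι : Type} (F : Finset ι) (n : ι → ℤ) (b : ι → ℂ),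
      ∫ x in (0 : ℝ)..(2 * π), ‖∑ i ∈ F with 0 ≤ n i, b i * cexp (n i * x * I)‖ ^ p ≤
        C * ∫ x in (0 : ℝ)..(2 * π), ‖∑ i ∈ F, b i * cexp (n i * x * I)‖ ^ p := by
  obtain ⟨C, hC, hb⟩ := rieszBound_of_one_lt hp
  refine ⟨C + 1, by positivity, fun {ι} F n b => ?_⟩
  let W : ℂ → ℂ := fun z => ∑ i ∈ F with 0 ≤ n i, b i * z ^ (n i).toNat
  let Z : ℂ → ℂ := fun z => ∑ i ∈ F with ¬ 0 ≤ n i, conj (b i) * z ^ (-n i).toNat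
  have hW : Differentiable ℂ W := by fun_prop
  have hZ : Differentiable ℂ Z := by fun_prop
  have hZ0 : Z 0 = 0 := Finset.sum_eq_zero fun i hi => by
    rw [zero_pow (by have := (Finset.mem_filter.1 hi).2; omega), mul_zero]
  have eW : ∀ x : ℝ, W (cexp (x * I)) = ∑ i ∈ F with 0 ≤ n i, b i * cexp (n i * x * I) :=
    fun x => Finset.sum_congr rfl fun i hi => by
      have : ((n i).toNat : ℤ) = n i := Int.toNat_of_nonneg (Finset.mem_filter.1 hi).2
      have : ((n i).toNat : ℂ) = n i := by exact_mod_cast congrArg (Int.cast (R := ℂ)) this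
      rw [← Complex.exp_nat_mul, this, mul_assoc]
  have eZ : ∀ x : ℝ, conj (Z (cexp (x * I))) =
      ∑ i ∈ F with ¬ 0 ≤ n i, b i * cexp (n i * x * I) := fun x => by
    simp only [Z, map_sum]
    refine Finset.sum_congr rfl fun i hi => ?_
    have : ((-n i).toNat : ℤ) = -n i :=
      Int.toNat_of_nonneg (by have := (Finset.mem_filter.1 hi).2; omega)
    have : ((-n i).toNat : ℂ) = -n i := by exact_mod_cast congrArg (Int.cast (R := ℂ)) this
    rw [← Complex.exp_nat_mul, this, map_mul, Complex.conj_conj, ← Complex.exp_conj]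
    simp [mul_assoc]
  have eF : ∀ x : ℝ, W (cexp (x * I)) + conj (Z (cexp (x * I))) =
      ∑ i ∈ F, b i * cexp (n i * x * I) := fun x => by
    rw [eW, eZ, Finset.sum_filter_add_sum_filter_not]
  have key := hb W Z hW hZ hZ0
  have cW := hW.continuous
  have cZ := hZ.continuous
  simp only [← eF, ← eW]
  rw [add_mul, one_mul]
  refine le_trans ?_ (add_le_add_left key _)
  have c1 : Continuous fun x : ℝ => ‖W (cexp (x * I))‖ ^ p :=
    Continuous.rpow_const (by fun_prop) fun _ => Or.inr (by linarith)
  have c2 : Continuous fun x : ℝ => ‖W (cexp (x * I)) - conj (Z (cexp (x * I)))‖ ^ p :=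
    Continuous.rpow_const (by fun_prop) fun _ => Or.inr (by linarith)
  have c3 : Continuous fun x : ℝ => ‖W (cexp (x * I)) + conj (Z (cexp (x * I)))‖ ^ p :=
    Continuous.rpow_const (by fun_prop) fun _ => Or.inr (by linarith)
  rw [← intervalIntegral.integral_add (c2.intervalIntegrable _ _) (c3.intervalIntegrable _ _)]
  refine intervalIntegral.integral_mono_on (by positivity) (c1.intervalIntegrable _ _)
    ((c2.add c3).intervalIntegrable _ _) fun x _ => ?_
  set w := W (cexp (x * I))
  set z := conj (Z (cexp (x * I)))
  have h1 : ‖w‖ ≤ max ‖w - z‖ ‖w + z‖ := by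
    have : 2 * ‖w‖ ≤ ‖w - z‖ + ‖w + z‖ := by
      have := norm_add_le (w - z) (w + z)
      rwa [show w - z + (w + z) = 2 * w by ring, norm_mul, Complex.norm_ofNat] at this
    linarith [le_max_left ‖w - z‖ ‖w + z‖, le_max_right ‖w - z‖ ‖w + z‖]
  refine (Real.rpow_le_rpow (norm_nonneg _) h1 (by linarith)).trans ?_
  have := Real.rpow_nonneg (norm_nonneg (w - z)) p
  have := Real.rpow_nonneg (norm_nonneg (w + z)) p
  rcases max_choice ‖w - z‖ ‖w + z‖ with h | h <;> rw [h] <;> linarith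

theorem intervalIntegral_swap_of_continuous {f : ℝ → ℝ → ℝ}
    (hf : Continuous (Function.uncurry f)) (a b c d : ℝ) :
    ∫ x in a..b, ∫ y in c..d, f x y = ∫ y in c..d, ∫ x in a..b, f x y := by
  refine intervalIntegral_intervalIntegral_swap ?_
  exact (hf.continuousOn.integrableOn_compact (isCompact_uIcc.prod isCompact_uIcc)).mono_set
    (Set.prod_mono uIoc_subset_uIcc uIoc_subset_uIcc)

theorem integral_mono_of_integral_le {f g : ℝ → ℝ → ℝ} {a b c d C : ℝ} (hab : a ≤ b)
    (hf : Continuous (Function.uncurry f)) (hg : Continuous (Function.uncurry g))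
    (h : ∀ x, ∫ y in c..d, f x y ≤ C * ∫ y in c..d, g x y) :
    ∫ x in a..b, ∫ y in c..d, f x y ≤ C * ∫ x in a..b, ∫ y in c..d, g x y := by
  have cf := intervalIntegral.continuous_parametric_intervalIntegral_of_continuous' hf c d
    (μ := volume)
  have cg := intervalIntegral.continuous_parametric_intervalIntegral_of_continuous' hg c d
    (μ := volume)
  rw [← intervalIntegral.integral_const_mul]
  exact intervalIntegral.integral_mono_on hab (cf.intervalIntegrable _ _)
    ((cg.const_mul C).intervalIntegrable _ _) fun x _ => h x

/-- Invariance of the integral over the torus under the shear `(x, y) ↦ (x + y, y)`. -/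
theorem integral_torus_shear {f : ℝ → ℝ → ℝ} (hf : Continuous (Function.uncurry f)) {T : ℝ}
    (hper : ∀ y, Function.Periodic (fun x => f x y) T) :
    ∫ x in 0..T, ∫ y in 0..T, f (x + y) y = ∫ x in 0..T, ∫ y in 0..T, f x y := by
  have hf' : Continuous (Function.uncurry fun x y => f (x + y) y) :=
    hf.comp (by fun_prop : Continuous fun q : ℝ × ℝ => (q.1 + q.2, q.2))
  rw [intervalIntegral_swap_of_continuous hf, intervalIntegral_swap_of_continuous hf']
  refine intervalIntegral.integral_congr fun y _ => ?_
  simp only [intervalIntegral.integral_comp_add_right (fun x => f x y), zero_add]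
  rw [add_comm T y, (hper y).intervalIntegral_add_eq y 0, zero_add]

/-- A trigonometric polynomial on the two-dimensional torus. -/
def torusPoly (F : Finset (ℤ × ℤ)) (a : ℤ × ℤ → ℂ) (x y : ℝ) : ℂ :=
  ∑ jk ∈ F, a jk * cexp ((jk.1 : ℂ) * (x : ℂ) * I) * cexp ((jk.2 : ℂ) * (y : ℂ) * I)

theorem continuous_norm_torusPoly_rpow {p : ℝ} (hp : 0 ≤ p) (F : Finset (ℤ × ℤ))
    (a : ℤ × ℤ → ℂ) {f g : ℝ × ℝ → ℝ} (hf : Continuous f) (hg : Continuous g) :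
    Continuous fun q => ‖torusPoly F a (f q) (g q)‖ ^ p := by
  refine Continuous.rpow_const ?_ fun _ => Or.inr hp
  simp only [torusPoly]
  fun_prop

theorem torusPoly_periodic (F : Finset (ℤ × ℤ)) (a : ℤ × ℤ → ℂ) (y : ℝ) :
    Function.Periodic (fun x => torusPoly F a x y) (2 * π) := fun x => by
  refine Finset.sum_congr rfl fun jk _ => ?_
  have : cexp (jk.1 * ((x + 2 * π : ℝ) : ℂ) * I) = cexp (jk.1 * x * I) := by
    rw [Complex.exp_eq_exp_iff_exists_int]
    exact ⟨jk.1, by push_cast; ring⟩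
  rw [this]

theorem exists_integral_torusPoly_fst_le {p : ℝ} (hp : 1 < p) :
    ∃ C : ℝ, 0 < C ∧ ∀ (F : Finset (ℤ × ℤ)) (a : ℤ × ℤ → ℂ),
      ∫ x in (0 : ℝ)..(2 * π), ∫ y in (0 : ℝ)..(2 * π),
          ‖torusPoly {jk ∈ F | 0 ≤ jk.1} a x y‖ ^ p ≤
        C * ∫ x in (0 : ℝ)..(2 * π), ∫ y in (0 : ℝ)..(2 * π), ‖torusPoly F a x y‖ ^ p := by
  obtain ⟨C, hC, hb⟩ := exists_integral_norm_sum_nonneg_le hp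
  refine ⟨C, hC, fun F a => ?_⟩
  have hp0 : 0 ≤ p := by linarith
  have cont : ∀ G : Finset (ℤ × ℤ),
      Continuous (Function.uncurry fun x y => ‖torusPoly G a x y‖ ^ p) := fun G =>
    continuous_norm_torusPoly_rpow hp0 G a continuous_fst continuous_snd
  rw [intervalIntegral_swap_of_continuous (cont _), intervalIntegral_swap_of_continuous (cont _)]
  refine integral_mono_of_integral_le
    (f := fun y x => ‖torusPoly {jk ∈ F | 0 ≤ jk.1} a x y‖ ^ p)
    (g := fun y x => ‖torusPoly F a x y‖ ^ p) (by positivity)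
    (continuous_norm_torusPoly_rpow hp0 _ a continuous_snd continuous_fst)
    (continuous_norm_torusPoly_rpow hp0 _ a continuous_snd continuous_fst) fun y => ?_
  have := hb F (fun jk => jk.1) fun jk => a jk * cexp (jk.2 * y * I)
  simpa only [torusPoly, mul_right_comm] using this

theorem exists_integral_torusPoly_add_le {p : ℝ} (hp : 1 < p) :
    ∃ C : ℝ, 0 < C ∧ ∀ (F : Finset (ℤ × ℤ)) (a : ℤ × ℤ → ℂ),
      ∫ x in (0 : ℝ)..(2 * π), ∫ y in (0 : ℝ)..(2 * π),
          ‖torusPoly {jk ∈ F | 0 ≤ jk.1 + jk.2 + 1} a x y‖ ^ p ≤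
        C * ∫ x in (0 : ℝ)..(2 * π), ∫ y in (0 : ℝ)..(2 * π), ‖torusPoly F a x y‖ ^ p := by
  obtain ⟨C, hC, hb⟩ := exists_integral_norm_sum_nonneg_le hp
  refine ⟨C, hC, fun F a => ?_⟩
  have hp0 : 0 ≤ p := by linarith
  have shear : ∀ G : Finset (ℤ × ℤ),
      ∫ x in (0 : ℝ)..(2 * π), ∫ y in (0 : ℝ)..(2 * π), ‖torusPoly G a x y‖ ^ p =
        ∫ x in (0 : ℝ)..(2 * π), ∫ y in (0 : ℝ)..(2 * π), ‖torusPoly G a (x + y) y‖ ^ p :=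
    fun G => (integral_torus_shear (f := fun x y => ‖torusPoly G a x y‖ ^ p)
      (continuous_norm_torusPoly_rpow hp0 G a continuous_fst continuous_snd) fun y x => by
      simp only [torusPoly_periodic G a y x]).symm
  have cont : ∀ G : Finset (ℤ × ℤ),
      Continuous (Function.uncurry fun x y => ‖torusPoly G a (x + y) y‖ ^ p) := fun G =>
    continuous_norm_torusPoly_rpow hp0 G a (continuous_fst.add continuous_snd) continuous_snd
  rw [shear, shear]
  refine integral_mono_of_integral_le
    (f := fun x y => ‖torusPoly {jk ∈ F | 0 ≤ jk.1 + jk.2 + 1} a (x + y) y‖ ^ p)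
    (g := fun x y => ‖torusPoly F a (x + y) y‖ ^ p) (by positivity) (cont _) (cont _) fun x => ?_
  have e : ∀ (G : Finset (ℤ × ℤ)) (y : ℝ), ‖torusPoly G a (x + y) y‖ =
      ‖∑ jk ∈ G, a jk * cexp (jk.1 * x * I) * cexp ((jk.1 + jk.2 + 1 : ℤ) * y * I)‖ := by
    intro G y
    have h1 : ‖cexp (y * I)‖ = 1 := Complex.norm_exp_ofReal_mul_I y
    rw [← one_mul ‖torusPoly G a (x + y) y‖, ← h1, ← norm_mul, torusPoly, Finset.mul_sum]
    congr 1
    refine Finset.sum_congr rfl fun jk _ => ?_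
    rw [mul_assoc (a jk), mul_assoc (a jk), mul_left_comm, ← Complex.exp_add, ← Complex.exp_add,
      ← Complex.exp_add]
    push_cast
    ring_nf
  simpa only [e] using hb F (fun jk => jk.1 + jk.2 + 1) fun jk => a jk * cexp (jk.1 * x * I)

/-- for every `p ∈ (1,∞)` there is `C_p > 0` such that for every trigonometric
polynomial `f(e^{iθ},e^{iγ}) = Σ a_{jk} e^{ijθ}e^{ikγ}` on the 2-torus, the function
`Sf = Σ_{j ≥ 0, j+k+1 ≥ 0} a_{jk} e^{ijθ}e^{ikγ}` satisfies `‖Sf‖_{L^p(𝕋²)} ≤ C_p ‖f‖_{L^p(𝕋²)}`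
(with respect to normalized measure `dθdγ/(4π²)`); i.e. the Szegő projection of the Hartogs
triangle extends to a bounded operator on `L^p(𝕋²)` for every `1 < p < ∞`. -/
theorem statement3 (p : ℝ) (hp : 1 < p) :
    ∃ C : ℝ, 0 < C ∧ ∀ (F : Finset (ℤ × ℤ)) (a : ℤ × ℤ → ℂ),
      ((1 / (4 * π ^ 2)) * ∫ θ in (0:ℝ)..(2 * π), ∫ γ in (0:ℝ)..(2 * π),
          ‖∑ jk ∈ F.filter (fun jk => 0 ≤ jk.1 ∧ 0 ≤ jk.1 + jk.2 + 1),
              a jk * Complex.exp ((jk.1 : ℂ) * (θ : ℂ) * Complex.I) *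
                Complex.exp ((jk.2 : ℂ) * (γ : ℂ) * Complex.I)‖ ^ p) ^ (1 / p) ≤
      C * ((1 / (4 * π ^ 2)) * ∫ θ in (0:ℝ)..(2 * π), ∫ γ in (0:ℝ)..(2 * π),
          ‖∑ jk ∈ F,
              a jk * Complex.exp ((jk.1 : ℂ) * (θ : ℂ) * Complex.I) *
                Complex.exp ((jk.2 : ℂ) * (γ : ℂ) * Complex.I)‖ ^ p) ^ (1 / p) := by
  obtain ⟨C₁, hC₁, h₁⟩ := exists_integral_torusPoly_fst_le hp
  obtain ⟨C₂, hC₂, h₂⟩ := exists_integral_torusPoly_add_le hp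
  refine ⟨(C₁ * C₂) ^ (1 / p), by positivity, fun F a => ?_⟩
  have nonneg : ∀ G : Finset (ℤ × ℤ),
      0 ≤ ∫ x in (0 : ℝ)..(2 * π), ∫ y in (0 : ℝ)..(2 * π), ‖torusPoly G a x y‖ ^ p := fun G =>
    intervalIntegral.integral_nonneg (by positivity) fun x _ =>
      intervalIntegral.integral_nonneg (by positivity) fun y _ => by positivity
  have key := (h₁ {jk ∈ F | 0 ≤ jk.1 + jk.2 + 1} a).trans
    (mul_le_mul_of_nonneg_left (h₂ F a) hC₁.le)
  rw [Finset.filter_filter] at key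
  simp only [and_comm (b := 0 ≤ (_ : ℤ × ℤ).1), ← mul_assoc] at key
  have hF := nonneg F
  have hG := nonneg {jk ∈ F | 0 ≤ jk.1 ∧ 0 ≤ jk.1 + jk.2 + 1}
  simp only [torusPoly] at key hF hG
  rw [← Real.mul_rpow (by positivity) (mul_nonneg (by positivity) hF)]
  refine Real.rpow_le_rpow (mul_nonneg (by positivity) hG) ?_ (by positivity)
  rw [mul_left_comm]
  exact mul_le_mul_of_nonneg_left key (by positivity)
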